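/- Let 𝔤 be the 5-dimensional real Lie algebra with basis {ξ, X₁, Y₁, X₂, Y₂} whose only non-vanishing Lie brackets among basis vectors are [ξ,X₁] = Y₁, [X₁,Y₁] = 2ξ, [X₂,Y₂] = 2(ξ + X₂), [X₁,X₂] = Y₁. Let g be the symmetric bilinear form whose only non-vanishing values on basis vectors are g(ξ,ξ) = g(X₁,Y₁) = g(X₂,Y₂) = 1, set η(X) = g(X,ξ), let φ : 𝔤 → 𝔤 be the linear map with φξ = 0, φXᵢ = Xᵢ and φYᵢ = −Yᵢ for i = 1,2, define h : 𝔤 → 𝔤 by hX = ½([ξ, φX] − φ[ξ, X]), and let ∇ be the Levi-Civita product of (𝔤,g) with curvature R. Then: (i) h X₁ = Y₁, h Y₁ = h X₂ = h Y₂ = 0 and h ξ = 0, so h ∘ h = 0 and h ≠ 0; (ii) R(Z,ξ)ξ = −Z + 2 h Z for every Z in the span of {X₁, Y₁, X₂, Y₂}; but (iii) R(X₁,X₂)ξ = −2Y₁ ≠ 0, so the identity R(X,Y)ξ = −(η(Y)X − η(X)Y) + 2(η(Y)hX − η(X)hY) fails for X = X₁, Y = X₂, i.e. the structure is a paracontact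 metric manifold with h² = 0 and h ≠ 0 that is not a (−1,2)-space. -/

import Mathlib

set_option linter.unusedSimpArgs false
set_option linter.unusedTactic false
set_option linter.unreachableTactic false

/-- The paper's Example 5.1: a 5-dimensional paracontact metric manifold with
`h² = 0` and `h ≠ 0` which satisfies `R(Z,ξ)ξ = -Z + 2hZ` for `Z` orthogonal
to `ξ` but is not a `(-1,2)`-space, since `R(X₁,X₂)ξ = -2Y₁ ≠ 0`. -/
theorem example_not_minus_one_two_space
    (𝔤 : Type*) [LieRing 𝔤] [LieAlgebra ℝ 𝔤]
    (ξ X1 Y1 X2 Y2 : 𝔤)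
    (b : Module.Basis (Fin 5) ℝ 𝔤) (hb : ∀ i, b i = ![ξ, X1, Y1, X2, Y2] i)
    -- the only non-vanishing Lie brackets among basis vectors:
    (br1 : ⁅ξ, X1⁆ = Y1)
    (br2 : ⁅ξ, Y1⁆ = 0) (br3 : ⁅ξ, X2⁆ = 0) (br4 : ⁅ξ, Y2⁆ = 0)
    (br5 : ⁅X1, Y1⁆ = (2 : ℝ) • ξ)
    (br6 : ⁅X1, X2⁆ = Y1) (br7 : ⁅X1, Y2⁆ = 0)
    (br8 : ⁅Y1, X2⁆ = 0) (br9 : ⁅Y1, Y2⁆ = 0)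
    (br10 : ⁅X2, Y2⁆ = (2 : ℝ) • (ξ + X2))
    -- the symmetric bilinear form:
    (g : 𝔤 →ₗ[ℝ] 𝔤 →ₗ[ℝ] ℝ) (hgsymm : ∀ x y : 𝔤, g x y = g y x)
    (hg1 : g ξ ξ = 1) (hg2 : g ξ X1 = 0) (hg3 : g ξ Y1 = 0) (hg4 : g ξ X2 = 0)
    (hg5 : g ξ Y2 = 0) (hg6 : g X1 X1 = 0) (hg7 : g X1 Y1 = 1) (hg8 : g X1 X2 = 0)
    (hg9 : g X1 Y2 = 0) (hg10 : g Y1 Y1 = 0) (hg11 : g Y1 X2 = 0) (hg12 : g Y1 Y2 = 0)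
    (hg13 : g X2 X2 = 0) (hg14 : g X2 Y2 = 1) (hg15 : g Y2 Y2 = 0)
    (η : 𝔤 → ℝ) (hη : ∀ x, η x = g x ξ)
    -- the structure tensor φ:
    (φ : 𝔤 →ₗ[ℝ] 𝔤)
    (hφξ : φ ξ = 0)
    (hφX1 : φ X1 = X1) (hφY1 : φ Y1 = -Y1)
    (hφX2 : φ X2 = X2) (hφY2 : φ Y2 = -Y2)
    -- the tensor h = ½ L_ξ φ:
    (h : 𝔤 →ₗ[ℝ] 𝔤)
    (hdef : ∀ x : 𝔤, h x = (1 / 2 : ℝ) • (⁅ξ, φ x⁆ - φ ⁅ξ, x⁆))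
    -- Levi-Civita product and curvature:
    (nabla : 𝔤 →ₗ[ℝ] 𝔤 →ₗ[ℝ] 𝔤)
    (hkoszul : ∀ x y z : 𝔤,
      2 * g (nabla x y) z = g ⁅x, y⁆ z - g ⁅y, z⁆ x + g ⁅z, x⁆ y)
    (R : 𝔤 → 𝔤 → 𝔤 → 𝔤)
    (hR : ∀ x y z : 𝔤,
      R x y z = nabla x (nabla y z) - nabla y (nabla x z) - nabla ⁅x, y⁆ z) :
    -- (i)
    (h X1 = Y1 ∧ h Y1 = 0 ∧ h X2 = 0 ∧ h Y2 = 0 ∧ h ξ = 0 ∧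
      h ∘ₗ h = 0 ∧ h ≠ 0) ∧
    -- (ii)
    (∀ z ∈ Submodule.span ℝ ({X1, Y1, X2, Y2} : Set 𝔤),
      R z ξ ξ = -z + (2 : ℝ) • h z) ∧
    -- (iii)
    (R X1 X2 ξ = -((2 : ℝ) • Y1) ∧ -((2 : ℝ) • Y1) ≠ 0 ∧
      R X1 X2 ξ ≠
        -(η X2 • X1 - η X1 • X2) + (2 : ℝ) • (η X2 • h X1 - η X1 • h X2)) := by
  have b0 : b 0 = ξ := hb 0
  have b1 : b 1 = X1 := hb 1
  have b2 : b 2 = Y1 := hb 2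
  have b3 : b 3 = X2 := hb 3
  have b4 : b 4 = Y2 := hb 4
  -- the reversed brackets
  have rev : ∀ x y : 𝔤, ⁅y, x⁆ = -⁅x, y⁆ := fun x y => (lie_skew y x).symm
  have c1 : ⁅X1, ξ⁆ = -Y1 := by rw [rev, br1]
  have c2 : ⁅Y1, ξ⁆ = 0 := by rw [rev, br2, neg_zero]
  have c3 : ⁅X2, ξ⁆ = 0 := by rw [rev, br3, neg_zero]
  have c4 : ⁅Y2, ξ⁆ = 0 := by rw [rev, br4, neg_zero]
  have c5 : ⁅Y1, X1⁆ = -((2 : ℝ) • ξ) := by rw [rev, br5]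
  have c6 : ⁅X2, X1⁆ = -Y1 := by rw [rev, br6]
  have c7 : ⁅Y2, X1⁆ = 0 := by rw [rev, br7, neg_zero]
  have c8 : ⁅X2, Y1⁆ = 0 := by rw [rev, br8, neg_zero]
  have c9 : ⁅Y2, Y1⁆ = 0 := by rw [rev, br9, neg_zero]
  have c10 : ⁅Y2, X2⁆ = -((2 : ℝ) • (ξ + X2)) := by rw [rev, br10]
  -- the reversed values of the form
  have g2 : g X1 ξ = 0 := by rw [hgsymm, hg2]
  have g3 : g Y1 ξ = 0 := by rw [hgsymm, hg3]
  have g4 : g X2 ξ = 0 := by rw [hgsymm, hg4]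
  have g5 : g Y2 ξ = 0 := by rw [hgsymm, hg5]
  have g7 : g Y1 X1 = 1 := by rw [hgsymm, hg7]
  have g8 : g X2 X1 = 0 := by rw [hgsymm, hg8]
  have g9 : g Y2 X1 = 0 := by rw [hgsymm, hg9]
  have g11 : g X2 Y1 = 0 := by rw [hgsymm, hg11]
  have g12 : g Y2 Y1 = 0 := by rw [hgsymm, hg12]
  have g14 : g Y2 X2 = 1 := by rw [hgsymm, hg14]
  -- nondegeneracy
  have nd : ∀ v : 𝔤, g v ξ = 0 → g v X1 = 0 → g v Y1 = 0 → g v X2 = 0 → g v Y2 = 0 → v = 0 := by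
    intro v e0 e1 e2 e3 e4
    have hv := b.sum_repr v
    rw [Fin.sum_univ_five, b0, b1, b2, b3, b4] at hv
    generalize b.repr v 0 = a0 at hv
    generalize b.repr v 1 = a1 at hv
    generalize b.repr v 2 = a2 at hv
    generalize b.repr v 3 = a3 at hv
    generalize b.repr v 4 = a4 at hv
    rw [← hv] at e0 e1 e2 e3 e4
    simp only [map_add, map_smul, LinearMap.add_apply, LinearMap.smul_apply, smul_eq_mul,
      hg1, hg2, hg3, hg4, hg5, hg6, hg7, hg8, hg9, hg10, hg11, hg12, hg13, hg14, hg15, g2, g3, g4, g5, g7, g8, g9, g11, g12, g14,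
      mul_zero, mul_one, add_zero, zero_add] at e0 e1 e2 e3 e4
    rw [e0, e1, e2, e3, e4] at hv
    rw [← hv]
    simp
  have key : ∀ x y w : 𝔤,
      (∀ z ∈ ({ξ, X1, Y1, X2, Y2} : Set 𝔤),
        2 * g w z = g ⁅x, y⁆ z - g ⁅y, z⁆ x + g ⁅z, x⁆ y) → nabla x y = w := by
    intro x y w hw
    have aux : ∀ z ∈ ({ξ, X1, Y1, X2, Y2} : Set 𝔤), g (nabla x y - w) z = 0 := by
      intro z hz
      have e1 := hw z hz
      have e2 := hkoszul x y z
      rw [map_sub, LinearMap.sub_apply]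
      linarith
    exact sub_eq_zero.mp (nd _ (aux _ (by simp)) (aux _ (by simp)) (aux _ (by simp))
      (aux _ (by simp)) (aux _ (by simp)))
  clear nd
  have n0 : nabla ξ ξ = 0 := by
    apply key
    rintro z (rfl | rfl | rfl | rfl | rfl) <;>
    simp [hg1, hg2, hg3, hg4, hg5, hg6, hg7, hg8, hg9, hg10, hg11, hg12, hg13, hg14, hg15, g2, g3, g4, g5, g7, g8, g9, g11, g12, g14,
      br1, br2, br3, br4, br5, br6, br7, br8, br9, br10, c1, c2, c3, c4, c5, c6, c7, c8, c9, c10] <;> norm_num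
  have n1 : nabla X1 ξ = -X1 - Y1 := by
    apply key
    rintro z (rfl | rfl | rfl | rfl | rfl) <;>
    simp [hg1, hg2, hg3, hg4, hg5, hg6, hg7, hg8, hg9, hg10, hg11, hg12, hg13, hg14, hg15, g2, g3, g4, g5, g7, g8, g9, g11, g12, g14,
      br1, br2, br3, br4, br5, br6, br7, br8, br9, br10, c1, c2, c3, c4, c5, c6, c7, c8, c9, c10] <;> norm_num
  have n2 : nabla Y1 ξ = Y1 := by
    apply key
    rintro z (rfl | rfl | rfl | rfl | rfl) <;>
    simp [hg1, hg2, hg3, hg4, hg5, hg6, hg7, hg8, hg9, hg10, hg11, hg12, hg13, hg14, hg15, g2, g3, g4, g5, g7, g8, g9, g11, g12, g14,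
      br1, br2, br3, br4, br5, br6, br7, br8, br9, br10, c1, c2, c3, c4, c5, c6, c7, c8, c9, c10] <;> norm_num
  have n3 : nabla X2 ξ = -X2 := by
    apply key
    rintro z (rfl | rfl | rfl | rfl | rfl) <;>
    simp [hg1, hg2, hg3, hg4, hg5, hg6, hg7, hg8, hg9, hg10, hg11, hg12, hg13, hg14, hg15, g2, g3, g4, g5, g7, g8, g9, g11, g12, g14,
      br1, br2, br3, br4, br5, br6, br7, br8, br9, br10, c1, c2, c3, c4, c5, c6, c7, c8, c9, c10] <;> norm_num
  have n4 : nabla Y2 ξ = Y2 := by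
    apply key
    rintro z (rfl | rfl | rfl | rfl | rfl) <;>
    simp [hg1, hg2, hg3, hg4, hg5, hg6, hg7, hg8, hg9, hg10, hg11, hg12, hg13, hg14, hg15, g2, g3, g4, g5, g7, g8, g9, g11, g12, g14,
      br1, br2, br3, br4, br5, br6, br7, br8, br9, br10, c1, c2, c3, c4, c5, c6, c7, c8, c9, c10] <;> norm_num
  have m1 : nabla ξ X1 = -X1 := by
    apply key
    rintro z (rfl | rfl | rfl | rfl | rfl) <;>
    simp [hg1, hg2, hg3, hg4, hg5, hg6, hg7, hg8, hg9, hg10, hg11, hg12, hg13, hg14, hg15, g2, g3, g4, g5, g7, g8, g9, g11, g12, g14,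
      br1, br2, br3, br4, br5, br6, br7, br8, br9, br10, c1, c2, c3, c4, c5, c6, c7, c8, c9, c10] <;> norm_num
  have m2 : nabla ξ Y1 = Y1 := by
    apply key
    rintro z (rfl | rfl | rfl | rfl | rfl) <;>
    simp [hg1, hg2, hg3, hg4, hg5, hg6, hg7, hg8, hg9, hg10, hg11, hg12, hg13, hg14, hg15, g2, g3, g4, g5, g7, g8, g9, g11, g12, g14,
      br1, br2, br3, br4, br5, br6, br7, br8, br9, br10, c1, c2, c3, c4, c5, c6, c7, c8, c9, c10] <;> norm_num
  have m3 : nabla ξ X2 = -X2 := by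
    apply key
    rintro z (rfl | rfl | rfl | rfl | rfl) <;>
    simp [hg1, hg2, hg3, hg4, hg5, hg6, hg7, hg8, hg9, hg10, hg11, hg12, hg13, hg14, hg15, g2, g3, g4, g5, g7, g8, g9, g11, g12, g14,
      br1, br2, br3, br4, br5, br6, br7, br8, br9, br10, c1, c2, c3, c4, c5, c6, c7, c8, c9, c10] <;> norm_num
  have m4 : nabla ξ Y2 = Y2 := by
    apply key
    rintro z (rfl | rfl | rfl | rfl | rfl) <;>
    simp [hg1, hg2, hg3, hg4, hg5, hg6, hg7, hg8, hg9, hg10, hg11, hg12, hg13, hg14, hg15, g2, g3, g4, g5, g7, g8, g9, g11, g12, g14,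
      br1, br2, br3, br4, br5, br6, br7, br8, br9, br10, c1, c2, c3, c4, c5, c6, c7, c8, c9, c10] <;> norm_num
  have k2 : nabla X2 Y1 = 0 := by
    apply key
    rintro z (rfl | rfl | rfl | rfl | rfl) <;>
    simp [hg1, hg2, hg3, hg4, hg5, hg6, hg7, hg8, hg9, hg10, hg11, hg12, hg13, hg14, hg15, g2, g3, g4, g5, g7, g8, g9, g11, g12, g14,
      br1, br2, br3, br4, br5, br6, br7, br8, br9, br10, c1, c2, c3, c4, c5, c6, c7, c8, c9, c10] <;> norm_num
  have kk : nabla X1 X2 - nabla X2 X1 = Y1 := by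
    refine sub_eq_iff_eq_add.mpr (key _ _ _ ?_)
    intro z _
    have e := hkoszul X2 X1 z
    rw [map_add, LinearMap.add_apply, mul_add, e, br6, c6, rev z X1, rev X2 z]
    simp only [map_neg, LinearMap.neg_apply]
    ring
  clear key
  have hX1 : h X1 = Y1 := by
    rw [hdef, hφX1, br1, hφY1, sub_neg_eq_add, ← two_smul ℝ Y1, smul_smul]
    norm_num
  have hY1 : h Y1 = 0 := by rw [hdef, hφY1, lie_neg, br2]; simp
  have hX2 : h X2 = 0 := by rw [hdef, hφX2, br3]; simp
  have hY2 : h Y2 = 0 := by rw [hdef, hφY2, lie_neg, br4]; simp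
  have hξ : h ξ = 0 := by rw [hdef, hφξ]; simp
  have hY1ne : Y1 ≠ 0 := b2 ▸ b.ne_zero 2
  have hne : -((2 : ℝ) • Y1) ≠ 0 := neg_ne_zero.mpr (smul_ne_zero two_ne_zero hY1ne)
  have hRR : R X1 X2 ξ = -((2 : ℝ) • Y1) := by
    rw [hR, n3, n1, br6, n2, map_neg, map_sub, map_neg, k2, two_smul]
    rw [sub_eq_iff_eq_add] at kk
    rw [kk]
    abel
  refine ⟨⟨hX1, hY1, hX2, hY2, hξ, ?_, ?_⟩, ?_, hRR, hne, ?_⟩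
  · refine b.ext fun i => ?_
    fin_cases i <;> simp [hb, hX1, hY1, hX2, hY2, hξ]
  · intro h0
    apply hY1ne
    rw [← hX1, h0, LinearMap.zero_apply]
  · intro z hz
    induction hz using Submodule.span_induction with
    | mem x hx =>
      rcases hx with rfl | rfl | rfl | rfl
      · rw [hR, n0, n1, c1, map_sub, map_neg, m1, m2, map_zero, map_neg, LinearMap.neg_apply, n2,
          hX1, two_smul]
        abel
      · simp [hR, n0, n2, m2, c2, hY1]
      · simp [hR, n0, n3, m3, c3, hX2]
      · simp [hR, n0, n4, m4, c4, hY2]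
    | zero => simp [hR]
    | add x y _ _ hx hy =>
      have e : R (x + y) ξ ξ = R x ξ ξ + R y ξ ξ := by
        simp only [hR, n0, map_add, LinearMap.add_apply, add_lie, map_zero]
        abel
      rw [e, hx, hy, map_add, smul_add]
      abel
    | smul a x _ hx =>
      have e : R (a • x) ξ ξ = a • R x ξ ξ := by
        simp only [hR, n0, map_smul, LinearMap.smul_apply, smul_lie, map_zero, smul_sub, smul_zero]
      rw [e, hx, map_smul, smul_add, smul_neg, smul_comm]
  · rw [hRR, hη, hη, g2, g4]
    simpa using hY1ne
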